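/- Let n, k, r, s be positive integers with k + r ≤ s ≤ (r−1)(k+1), and set a = ⌊(s−r)/k⌋ + 1 (so 2 ≤ a ≤ r−1). Let H be an r-graph on n vertices with matching number ν(H) ≤ k. If n ≥ 4r²k·(e·r/(a−1))^{s−r+a} (where e is Euler's number), then K_s^r(H) ≤ K_s^r(F^{(r)}_{n,k,a}). -/

import Mathlib

open Finset

/-- The number of `s`-cliques of the `r`-uniform hypergraph `H`
(sets of `s` vertices all of whose `r`-element subsets are edges). -/
def cliqueCount {V : Type*} [Fintype V] [DecidableEq V] (r s : ℕ)
    (H : Finset (Finset V)) : ℕ :=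
  ((Finset.univ.powersetCard s).filter (fun S => S.powersetCard r ⊆ H)).card

/-- The hypergraph `F^{(r)}_{n,k,a}` on `Fin n`: all `r`-element subsets having
at least `a` elements among the first `a*k + a - 1` vertices. -/
def Fnka (n k r a : ℕ) : Finset (Finset (Fin n)) :=
  (Finset.univ.powersetCard r).filter
    (fun E => a ≤ (E.filter (fun x : Fin n => (x : ℕ) < a * k + a - 1)).card)

/-- The matching number of `H` is at most `k`. -/
def matchingLE {V : Type*} (H : Finset (Finset V)) (k : ℕ) : Prop :=
  ∀ M ⊆ H, (M : Set (Finset V)).Pairwise Disjoint → M.card ≤ k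

/-- The degree of a vertex set `A`: the number of edges of `H` containing `A`. -/
def degOf {V : Type*} [DecidableEq V] (H : Finset (Finset V)) (A : Finset V) : ℕ :=
  (H.filter (fun E => A ⊆ E)).card

/-- The shifting operator `S_{ij}` applied to a single edge. -/
def shiftEdge {n : ℕ} (H : Finset (Finset (Fin n))) (i j : Fin n)
    (E : Finset (Fin n)) : Finset (Fin n) :=
  if j ∈ E ∧ i ∉ E ∧ insert i (E.erase j) ∉ H then insert i (E.erase j) else E

/-- The shifted hypergraph `S_{ij}(H)`. -/
def shift {n : ℕ} (H : Finset (Finset (Fin n))) (i j : Fin n) :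
    Finset (Finset (Fin n)) :=
  H.image (shiftEdge H i j)

/-- `H` is stable if it is invariant under all shifts `S_{ij}` with `i < j`. -/
def IsStable {n : ℕ} (H : Finset (Finset (Fin n))) : Prop :=
  ∀ i j : Fin n, i < j → shift H i j = H

/-- The `s`-cliques on the vertex set `range n` of an `r`-uniform family on `ℕ`. -/
def cliquesOn (n r s : ℕ) (H : Finset (Finset ℕ)) : Finset (Finset ℕ) :=
  (powersetCard s (range n)).filter fun S => powersetCard r S ⊆ H

lemma mem_cliquesOn {n r s : ℕ} {H : Finset (Finset ℕ)} {S : Finset ℕ} :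
    S ∈ cliquesOn n r s H ↔
      (S ⊆ range n ∧ S.card = s) ∧ ∀ F ⊆ S, F.card = r → F ∈ H := by
  simp only [cliquesOn, mem_filter, mem_powersetCard, subset_iff (s₂ := H), and_imp]

/-- The image of `E` when `j` is replaced by `i` relative to the family `H`. -/
def replaceIn (H : Finset (Finset ℕ)) (i j : ℕ) (E : Finset ℕ) : Finset ℕ :=
  if j ∈ E ∧ i ∉ E ∧ insert i (E.erase j) ∉ H then insert i (E.erase j) else E

/-- A family of finite sets of naturals closed under replacing an element by a smaller one. -/
def IsDownShifted (H : Finset (Finset ℕ)) : Prop :=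
  ∀ E ∈ H, ∀ j ∈ E, ∀ i ∉ E, i < j → insert i (E.erase j) ∈ H

lemma insert_erase_insert_erase {i j : ℕ} {E : Finset ℕ} (hj : j ∈ E) (hi : i ∉ E) :
    insert j ((insert i (E.erase j)).erase i) = E := by
  ext x
  simp only [mem_insert, mem_erase]
  grind

lemma card_insert_erase {i j : ℕ} {E : Finset ℕ} (hj : j ∈ E) (hi : i ∉ E) :
    (insert i (E.erase j)).card = E.card := by
  rw [card_insert_of_notMem (by simp [hi]), card_erase_add_one hj]

lemma injOn_replaceIn (H : Finset (Finset ℕ)) (i j : ℕ) :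
    Set.InjOn (replaceIn H i j) H := by
  intro E hE F hF h
  simp only [mem_coe] at hE hF
  unfold replaceIn at h
  split_ifs at h with h1 h2 h2
  · rw [← insert_erase_insert_erase h1.1 h1.2.1, h, insert_erase_insert_erase h2.1 h2.2.1]
  · exact absurd (h ▸ hF) h1.2.2
  · exact absurd (h ▸ hE) h2.2.2
  · exact h

lemma mem_image_replaceIn {H : Finset (Finset ℕ)} {i j : ℕ} (hij : i ≠ j) {E : Finset ℕ} :
    E ∈ H.image (replaceIn H i j) ↔
      (E ∈ H ∧ (j ∈ E → i ∉ E → insert i (E.erase j) ∈ H)) ∨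
      (E ∉ H ∧ i ∈ E ∧ j ∉ E ∧ insert j (E.erase i) ∈ H) := by
  rw [mem_image]
  constructor
  · rintro ⟨F, hF, rfl⟩
    unfold replaceIn
    split_ifs with h
    · refine Or.inr ⟨h.2.2, by simp, by simp [hij.symm], ?_⟩
      rwa [insert_erase_insert_erase h.1 h.2.1]
    · exact Or.inl ⟨hF, fun h1 h2 => by_contra fun h3 => h ⟨h1, h2, h3⟩⟩
  · rintro (⟨h1, h2⟩ | ⟨h1, h2, h3, h4⟩)
    · exact ⟨E, h1, if_neg fun h => h.2.2 (h2 h.1 h.2.1)⟩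
    · refine ⟨_, h4, ?_⟩
      have h5 := insert_erase_insert_erase h2 h3
      rw [replaceIn, h5, if_pos ⟨by simp, by simp [hij], h1⟩]

lemma card_le_card_cliquesOn_image_replaceIn {n r s i j : ℕ} (H : Finset (Finset ℕ))
    (hij : i < j) :
    (cliquesOn n r s H).card ≤ (cliquesOn n r s (H.image (replaceIn H i j))).card := by
  rw [← card_image_of_injOn (injOn_replaceIn (cliquesOn n r s H) i j)]
  apply card_le_card
  intro S hS
  rw [mem_image_replaceIn hij.ne] at hS
  rw [mem_cliquesOn]
  rcases hS with ⟨hS, h2⟩ | ⟨hS, hiS, hjS, h4⟩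
  · rw [mem_cliquesOn] at hS
    refine ⟨hS.1, fun F hFS hFr => ?_⟩
    rw [mem_image_replaceIn hij.ne]
    refine Or.inl ⟨hS.2 F hFS hFr, fun hjF hiF => ?_⟩
    have hc := card_insert_erase hjF hiF
    by_cases hi : i ∈ S
    · exact hS.2 _ (by grind) (hc.trans hFr)
    · have := h2 (hFS hjF) hi
      rw [mem_cliquesOn] at this
      exact this.2 _ (insert_subset_insert _ (erase_subset_erase _ hFS)) (hc.trans hFr)
  · rw [mem_cliquesOn] at h4
    have hc := card_insert_erase hiS hjS
    refine ⟨⟨fun x hx => ?_, hc.symm.trans h4.1.2⟩, fun F hFS hFr => ?_⟩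
    · by_cases hxi : x = i
      · have := mem_range.1 (h4.1.1 (mem_insert_self j _))
        exact mem_range.2 (by omega)
      · exact h4.1.1 (by simp [hxi, hx])
    · rw [mem_image_replaceIn hij.ne]
      have hjF : j ∉ F := fun h => hjS (hFS h)
      by_cases hiF : i ∈ F
      · by_cases hFH : F ∈ H
        · exact Or.inl ⟨hFH, fun h => absurd h hjF⟩
        · exact Or.inr ⟨hFH, hiF, hjF, h4.2 _
            (insert_subset_insert _ (erase_subset_erase _ hFS))
            ((card_insert_erase hiF hjF).trans hFr)⟩
      · exact Or.inl ⟨h4.2 F (by grind) hFr, fun h => absurd h hjF⟩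

lemma map_swap_eq_insert_erase {i j : ℕ} {E : Finset ℕ} (hj : j ∈ E) (hi : i ∉ E) :
    E.map (Equiv.swap i j).toEmbedding = insert i (E.erase j) := by
  ext x
  simp only [mem_map_equiv, Equiv.symm_swap, mem_insert, mem_erase, Equiv.swap_apply_def]
  grind

lemma map_swap_eq_self {i j : ℕ} {E : Finset ℕ} (hj : j ∉ E) (hi : i ∉ E) :
    E.map (Equiv.swap i j).toEmbedding = E := by
  ext x
  simp only [mem_map_equiv, Equiv.symm_swap, Equiv.swap_apply_def]
  grind

lemma matchingLE.image_replaceIn {H : Finset (Finset ℕ)} {k i j : ℕ} (hM : matchingLE H k)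
    (hij : i ≠ j) : matchingLE (H.image (replaceIn H i j)) k := by
  intro M hMH hdisj
  by_cases hsub : M ⊆ H
  · exact hM M hsub hdisj
  obtain ⟨E, hEM, hEH⟩ := not_subset.1 hsub
  have hE := mem_image_replaceIn hij |>.1 (hMH hEM)
  obtain ⟨-, hiE, hjE, hE'⟩ := hE.resolve_left fun h => hEH h.1
  have hM' := hM (M.map (mapEmbedding (Equiv.swap i j).toEmbedding).toEmbedding) ?_ ?_
  · rwa [card_map] at hM'
  · intro F hF
    obtain ⟨G, hG, rfl⟩ := mem_map.1 hF
    simp only [RelEmbedding.coe_toEmbedding, mapEmbedding_apply]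
    by_cases hGE : G = E
    · subst hGE
      rw [Equiv.swap_comm, map_swap_eq_insert_erase hiE hjE]
      exact hE'
    · have hd := hdisj hG hEM hGE
      have hiG : i ∉ G := fun h => disjoint_left.1 hd h hiE
      have hG' := (mem_image_replaceIn hij |>.1 (hMH hG)).resolve_right fun h => hiG h.2.1
      by_cases hjG : j ∈ G
      · rw [map_swap_eq_insert_erase hjG hiG]
        exact hG'.2 hjG hiG
      · rw [map_swap_eq_self hjG hiG]
        exact hG'.1
  · rw [coe_map]
    rintro _ ⟨G, hG, rfl⟩ _ ⟨G', hG', rfl⟩ hne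
    simp only [RelEmbedding.coe_toEmbedding, mapEmbedding_apply, disjoint_map]
    exact hdisj hG hG' fun h => hne (by rw [h])

lemma sum_replaceIn_le {H : Finset (Finset ℕ)} {i j : ℕ} (hij : i < j) (E : Finset ℕ) :
    ∑ x ∈ replaceIn H i j E, x ≤ ∑ x ∈ E, x := by
  unfold replaceIn
  split_ifs with h
  · rw [sum_insert (by simp [h.2.1]), ← add_sum_erase _ _ h.1]
    omega
  · exact le_rfl

lemma exists_isDownShifted {n r k : ℕ} (s : ℕ) (H : Finset (Finset ℕ))
    (hr : H ⊆ powersetCard r (range n)) (hM : matchingLE H k) :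
    ∃ H' ⊆ powersetCard r (range n), matchingLE H' k ∧ IsDownShifted H' ∧
      (cliquesOn n r s H).card ≤ (cliquesOn n r s H').card := by
  induction hw : ∑ E ∈ H, ∑ x ∈ E, x using Nat.strong_induction_on generalizing H with
  | _ w ih =>
    subst hw
    by_cases hs : IsDownShifted H
    · exact ⟨H, hr, hM, hs, le_rfl⟩
    simp only [IsDownShifted, not_forall] at hs
    obtain ⟨E, hE, j, hj, i, hi, hij, hEH⟩ := hs
    have hlt : ∑ E ∈ H.image (replaceIn H i j), ∑ x ∈ E, x < ∑ E ∈ H, ∑ x ∈ E, x := by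
      rw [sum_image (injOn_replaceIn H i j)]
      refine sum_lt_sum (fun F _ => sum_replaceIn_le hij F) ⟨E, hE, ?_⟩
      rw [replaceIn, if_pos ⟨hj, hi, hEH⟩, sum_insert (by simp [hi]), ← add_sum_erase _ _ hj]
      omega
    have hr' : H.image (replaceIn H i j) ⊆ powersetCard r (range n) := by
      intro F hF
      rcases (mem_image_replaceIn hij.ne).1 hF with h | ⟨-, hiF, hjF, h⟩
      · exact hr h.1
      · have h' := mem_powersetCard.1 (hr h)
        refine mem_powersetCard.2 ⟨fun x hx => ?_, (card_insert_erase hiF hjF).symm.trans h'.2⟩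
        by_cases hxi : x = i
        · have := mem_range.1 (h'.1 (mem_insert_self j _))
          exact mem_range.2 (by omega)
        · exact h'.1 (by simp [hxi, hx])
    obtain ⟨H', h1, h2, h3, h4⟩ := ih _ hlt _ hr' (hM.image_replaceIn hij.ne) rfl
    exact ⟨H', h1, h2, h3, (card_le_card_cliquesOn_image_replaceIn H hij).trans h4⟩

lemma IsDownShifted.mem_of_forall_lt {H : Finset (Finset ℕ)} (hH : IsDownShifted H)
    {E F : Finset ℕ} (hE : E ∈ H) (hc : F.card = E.card)
    (hlt : ∀ x ∈ F, x ∉ E → ∀ y ∈ E, y ∉ F → x < y) : F ∈ H := by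
  induction hd : (F \ E).card generalizing E with
  | zero =>
    have hFE : F ⊆ E := sdiff_eq_empty_iff_subset.1 (card_eq_zero.1 hd)
    rwa [eq_of_subset_of_card_le hFE hc.ge]
  | succ d ih =>
    obtain ⟨x, hx⟩ : (F \ E).Nonempty := card_pos.1 (by omega)
    obtain ⟨y, hy⟩ : (E \ F).Nonempty := card_pos.1 (by
      rw [← card_sdiff_comm hc]; omega)
    rw [mem_sdiff] at hx hy
    refine ih (hH E hE y hy.1 x hx.2 (hlt x hx.1 hx.2 y hy.1 hy.2))
      (hc.trans (card_insert_erase hy.1 hx.2).symm) (fun u hu hu' v hv hv' => ?_) ?_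
    · refine hlt u hu (fun h => hu' ?_) v ?_ hv'
      · have : u ≠ y := fun h => hy.2 (h ▸ hu)
        simp [this, h]
      · have : v ≠ x := fun h => hv' (h ▸ hx.1)
        simp only [mem_insert, this, mem_erase, false_or] at hv
        exact hv.2
    · have : F \ insert x (E.erase y) = (F \ E).erase x := by
        ext u
        simp only [mem_sdiff, mem_insert, mem_erase]
        grind
      rw [this, card_erase_of_mem (by simp [hx]), hd]
      rfl

lemma IsDownShifted.cliquesOn {n r s : ℕ} {H : Finset (Finset ℕ)} (hH : IsDownShifted H) :
    IsDownShifted (cliquesOn n r s H) := by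
  intro S hS j hj i hi hij
  rw [mem_cliquesOn] at hS ⊢
  refine ⟨⟨insert_subset ?_ ((erase_subset _ _).trans hS.1.1),
    (card_insert_erase hj hi).trans hS.1.2⟩, fun F hF hFr => ?_⟩
  · have := mem_range.1 (hS.1.1 hj)
    exact mem_range.2 (by omega)
  · by_cases hiF : i ∈ F
    · have hjF : j ∉ F := fun h => by
        have := hF h
        simp [hij.ne'] at this
      have h := hS.2 (insert j (F.erase i)) (by grind) ((card_insert_erase hiF hjF).trans hFr)
      have h' := hH _ h j (mem_insert_self _ _) i (by simp [hij.ne]) hij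
      rwa [insert_erase_insert_erase hiF hjF] at h'
    · exact hS.2 F (by grind) hFr

/-- The `i`-th of the consecutive intervals of length `w` starting at `c`. -/
def block (c w i : ℕ) : Finset ℕ := Ico (c + w * i) (c + w * i + w)

lemma card_block (c w i : ℕ) : (block c w i).card = w := by
  simp [block]

lemma block_subset {c w i K : ℕ} (h : i < K) : block c w i ⊆ Ico c (c + w * K) := by
  have : w * (i + 1) ≤ w * K := Nat.mul_le_mul_left _ h
  rw [mul_add] at this
  exact Ico_subset_Ico (by omega) (by omega)

lemma disjoint_block {c w i j : ℕ} (h : i < j) : Disjoint (block c w i) (block c w j) := by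
  have : w * (i + 1) ≤ w * j := Nat.mul_le_mul_left _ h
  rw [mul_add] at this
  rw [disjoint_left]
  intro x hx hx'
  simp only [block, mem_Ico] at hx hx'
  omega

lemma matchingLE.exists_not_disjoint {H : Finset (Finset ℕ)} {k : ℕ} (hM : matchingLE H k)
    (f : ℕ → Finset ℕ) (hf : ∀ i ≤ k, f i ∈ H ∧ (f i).Nonempty) :
    ∃ i j, i < j ∧ j ≤ k ∧ ¬ Disjoint (f i) (f j) := by
  by_contra! hcon
  have hd : ∀ i ≤ k, ∀ j ≤ k, i ≠ j → Disjoint (f i) (f j) := by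
    intro i hi j hj hij
    rcases lt_or_gt_of_ne hij with h | h
    · exact hcon i j h hj
    · exact (hcon j i h hi).symm
  have hinj : Set.InjOn f (range (k + 1)) := by
    intro i hi j hj hij
    by_contra hne
    simp only [coe_range, Set.mem_Iio] at hi hj
    have := hd i (by omega) j (by omega) hne
    rw [hij, disjoint_self] at this
    exact (hf j (by omega)).2.ne_empty this
  have := hM ((range (k + 1)).image f) ?_ ?_
  · rw [card_image_of_injOn hinj, card_range] at this
    omega
  · intro E hE
    obtain ⟨i, hi, rfl⟩ := mem_image.1 hE
    exact (hf i (by have := mem_range.1 hi; omega)).1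
  · rw [coe_image]
    rintro _ ⟨i, hi, rfl⟩ _ ⟨j, hj, rfl⟩ hne
    simp only [coe_range, Set.mem_Iio] at hi hj
    exact hd i (by omega) j (by omega) fun h => hne (by rw [h])

lemma sdiff_subset_range_of_far {n k b t p : ℕ} {H : Finset (Finset ℕ)} (hH : IsDownShifted H)
    (hM : matchingLE H k) (hp : b * (k + 1) < p) (hp' : p < (b + 1) * (k + 1))
    {S U : Finset ℕ} (hS : S ∈ cliquesOn n (b + 1 + t) (p + t) H) (hUS : U ⊆ S)
    (hU : U.card = t) (hfar : ∀ u ∈ U, (b + 1 + t) * (k + 1) ≤ u) :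
    S \ U ⊆ range (b * (k + 1) + k) := by
  intro y hy
  rw [mem_sdiff] at hy
  rw [mem_range]
  by_contra! hyk
  have e1 : (b + 1) * (k + 1) = b * (k + 1) + (k + 1) := by ring
  have e2 : (b + 1 + t) * (k + 1) = b * (k + 1) + (k + 1) + t * (k + 1) := by ring
  rw [e1] at hp'
  rw [e2] at hfar
  generalize hq : b * (k + 1) = q at *
  have hyU : (insert y U).card = t + 1 := by rw [card_insert_of_notMem hy.2, hU]
  have hdisj : Disjoint (range (p - 1)) (insert y U) := by
    rw [disjoint_left]
    intro x hx hx'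
    rw [mem_range] at hx
    rcases mem_insert.1 hx' with rfl | h
    · omega
    · have := hfar x h
      omega
  have hclique : range (p - 1) ∪ insert y U ∈ cliquesOn n (b + 1 + t) (p + t) H := by
    refine hH.cliquesOn.mem_of_forall_lt hS ?_ ?_
    · rw [card_union_of_disjoint hdisj, hyU, card_range, (mem_cliquesOn.1 hS).1.2]
      omega
    · intro x hx hxS v hv hvF
      have h1 : x ∈ range (p - 1) := by
        rcases mem_union.1 hx with h | h
        · exact h
        · rcases mem_insert.1 h with rfl | h
          · exact absurd hy.1 hxS
          · exact absurd (hUS h) hxS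
      have h2 : v ∉ range (p - 1) := fun h => hvF (mem_union_left _ h)
      rw [mem_range] at h1 h2
      omega
  have hD : ∀ i ≤ k, ∀ x ∈ block 0 b i, x < q := fun i hi x hx => by
    have := mem_Ico.1 (block_subset (Nat.lt_succ_of_le hi) hx)
    rw [Nat.succ_eq_add_one, hq] at this
    omega
  have hC : ∀ i ≤ k, ∀ x ∈ block (q + (k + 1)) t i,
      q + (k + 1) ≤ x ∧ x < q + (k + 1) + t * (k + 1) := fun i hi x hx =>
    mem_Ico.1 (block_subset (Nat.lt_succ_of_le hi) hx)
  have hcard : ∀ i ≤ k, ∀ z ≥ q, ∀ W : Finset ℕ, W.card = t → (∀ w ∈ W, q ≤ w) → z ∉ W →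
      (block 0 b i ∪ insert z W).card = b + 1 + t := by
    intro i hi z hz W hW hqW hzW
    rw [card_union_of_disjoint, card_insert_of_notMem hzW, card_block, hW]
    · omega
    · rw [disjoint_left]
      intro x hx hx'
      have := hD i hi x hx
      rcases mem_insert.1 hx' with rfl | h
      · omega
      · have := hqW x h
        omega
  have hqU : ∀ u ∈ U, q ≤ u := fun u hu => by have := hfar u hu; omega
  have hedge : ∀ i ≤ k, block 0 b i ∪ insert (q + i) (block (q + (k + 1)) t i) ∈ H := by
    intro i hi
    have c1 := hcard i hi y (by omega) U hU hqU hy.2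
    have hiU : q + i ∉ U := fun h => by have := hfar _ h; omega
    have c2 := hcard i hi (q + i) (by omega) U hU hqU hiU
    have c3 := hcard i hi (q + i) (by omega) _ (card_block _ _ _)
      (fun w hw => by have := hC i hi w hw; omega) (fun h => by have := hC i hi _ h; omega)
    have m1 : block 0 b i ∪ insert y U ∈ H := by
      refine (mem_cliquesOn.1 hclique).2 _ (union_subset_union ?_ subset_rfl) c1
      intro x hx
      have := hD i hi x hx
      exact mem_range.2 (by omega)
    have m2 : block 0 b i ∪ insert (q + i) U ∈ H := by
      refine hH.mem_of_forall_lt m1 (c2.trans c1.symm) fun x hx hx' v hv hv' => ?_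
      have h1 : x = q + i := by grind
      have h2 : v = y := by grind
      have h3 : x ≠ y := by grind
      omega
    refine hH.mem_of_forall_lt m2 (c3.trans c2.symm) fun x hx hx' v hv hv' => ?_
    have h1 := hC i hi x (by grind)
    have h2 := hfar v (by grind)
    omega
  obtain ⟨i, j, hij, hj, hnd⟩ := hM.exists_not_disjoint _ fun i hi =>
    ⟨hedge i hi, q + i, by simp⟩
  apply hnd
  rw [disjoint_left]
  intro x hx hx'
  have d1 := disjoint_left.1 (disjoint_block (c := 0) (w := b) hij)
  specialize @d1 x
  have d2 := disjoint_left.1 (disjoint_block (c := q + (k + 1)) (w := t) hij)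
  specialize @d2 x
  have a1 := hD i (by omega) x
  have a2 := hD j hj x
  have a3 := hC i (by omega) x
  have a4 := hC j hj x
  simp only [mem_union, mem_insert] at hx hx'
  rcases hx with h | h | h <;> rcases hx' with h' | h' | h' <;>
    grind

lemma exists_forall_inter_ne {n k b t p : ℕ} {H : Finset (Finset ℕ)} (hH : IsDownShifted H)
    (hM : matchingLE H k) (hp : b * (k + 1) < p) (hp' : p < (b + 1) * (k + 1))
    {S₀ : Finset ℕ} (hS₀ : S₀ ∈ cliquesOn n (b + 1 + t) (p + t) H)
    (hlt : (S₀ ∩ range (b * (k + 1) + k)).card < p) :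
    ∃ B ⊆ range (b * (k + 1) + k), B.card = p ∧
      ∀ S ∈ cliquesOn n (b + 1 + t) (p + t) H, S ∩ range ((b + 1 + t) * (k + 1)) ≠ B := by
  by_contra! hcon
  have e1 : (b + 1) * (k + 1) = b * (k + 1) + (k + 1) := by ring
  have e2 : (b + 1 + t) * (k + 1) = b * (k + 1) + (k + 1) + t * k + t := by ring
  have e3 : b * (k + 1) + k = b + (b + 1) * k := by ring
  have hbp : b < p := lt_of_le_of_lt (Nat.le_mul_of_pos_right b (by omega)) hp
  rw [e1] at hp'
  rw [e2] at hcon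
  generalize hN : b * (k + 1) + k = N at *
  -- every `(b + 1)`-subset of the core extends to an edge by far vertices
  have hfar : ∀ D ⊆ range N, D.card = b + 1 → ∃ Q : Finset ℕ, Q.card = t ∧
      (∀ x ∈ Q, N + 1 + t * k + t ≤ x) ∧ D ∪ Q ∈ H := by
    intro D hD hDc
    obtain ⟨B, hDB, hBN, hBp⟩ := exists_subsuperset_card_eq hD (n := p) (by omega)
      (by rw [card_range]; omega)
    obtain ⟨S, hS, hSB⟩ := hcon B hBN hBp
    rw [show b * (k + 1) + (k + 1) + t * k + t = N + 1 + t * k + t by omega] at hSB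
    have hSc := mem_cliquesOn.1 hS
    have hQ : (S \ range (N + 1 + t * k + t)).card = t := by
      have := card_inter_add_card_sdiff S (range (N + 1 + t * k + t))
      rw [hSB, hBp, hSc.1.2] at this
      omega
    refine ⟨S \ range (N + 1 + t * k + t), hQ, ?_, hSc.2 _ ?_ ?_⟩
    · intro x hx
      simpa using (mem_sdiff.1 hx).2
    · refine union_subset (hDB.trans ?_) sdiff_subset
      rw [← hSB]
      exact inter_subset_left
    · rw [card_union_of_disjoint, hDc, hQ]
      exact disjoint_sdiff.mono_left (hDB.trans (by rw [← hSB]; exact inter_subset_right))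
  have hlast : range b ∪ Ico N (N + 1 + t) ∈ H := by
    have hSc := mem_cliquesOn.1 hS₀
    have hc := card_inter_add_card_sdiff S₀ (range N)
    obtain ⟨R, hRS, hR⟩ := exists_subset_card_eq (s := S₀ \ range N) (n := t + 1) (by omega)
    have hRN : ∀ x ∈ R, N ≤ x := fun x hx => by simpa using (mem_sdiff.1 (hRS hx)).2
    have hRS' : R ⊆ S₀ := hRS.trans sdiff_subset
    obtain ⟨P, hPS, hP⟩ := exists_subset_card_eq (s := S₀ \ R) (n := b) (by
      rw [card_sdiff_of_subset hRS']; omega)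
    have hPR : Disjoint P R := disjoint_of_subset_left hPS sdiff_disjoint
    have m1 : P ∪ R ∈ H := hSc.2 _ (union_subset (hPS.trans sdiff_subset) hRS') (by
      rw [card_union_of_disjoint hPR]; omega)
    have hbN : b ≤ N := by
      rw [e3]; omega
    have hbR : Disjoint (range b) R := by
      rw [disjoint_left]
      intro x hx hx'
      have := hRN x hx'
      rw [mem_range] at hx
      omega
    have m2 : range b ∪ R ∈ H := by
      refine hH.mem_of_forall_lt m1 ?_ fun x hx hx' v hv hv' => ?_
      · rw [card_union_of_disjoint hbR, card_union_of_disjoint hPR, hP, card_range]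
      · have h1 : x < b := by grind
        have h2 : ¬ v < b := by grind
        omega
    refine hH.mem_of_forall_lt m2 ?_ fun x hx hx' v hv hv' => ?_
    · rw [card_union_of_disjoint hbR, card_union_of_disjoint, Nat.card_Ico, hR]
      · omega
      · rw [disjoint_left]
        intro x hx hx'
        rw [mem_range] at hx
        rw [mem_Ico] at hx'
        omega
    · have h1 : x < N + 1 + t := by grind
      have h2 : v ∈ R := by grind
      have h3 := hRN v h2
      have h4 : ¬ (N ≤ v ∧ v < N + 1 + t) := by grind
      omega
  have hD : ∀ i < k, ∀ x ∈ block b (b + 1) i, b ≤ x ∧ x < N := fun i hi x hx => by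
    rw [e3]
    exact mem_Ico.1 (block_subset hi hx)
  have hC : ∀ i < k, ∀ x ∈ block (N + 1 + t) t i, N + 1 + t ≤ x ∧ x < N + 1 + t + t * k :=
    fun i hi x hx => mem_Ico.1 (block_subset hi hx)
  have hedge : ∀ i < k, block b (b + 1) i ∪ block (N + 1 + t) t i ∈ H := by
    intro i hi
    obtain ⟨Q, hQ, hQfar, hDQ⟩ := hfar (block b (b + 1) i)
      (fun x hx => mem_range.2 (hD i hi x hx).2) (card_block _ _ _)
    refine hH.mem_of_forall_lt hDQ ?_ fun x hx hx' v hv hv' => ?_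
    · rw [card_union_of_disjoint, card_union_of_disjoint, hQ, card_block, card_block]
      · rw [disjoint_left]
        intro x hx hx'
        have := hD i hi x hx
        have := hQfar x hx'
        omega
      · rw [disjoint_left]
        intro x hx hx'
        have := hD i hi x hx
        have := hC i hi x hx'
        omega
    · have h1 := hC i hi x (by grind)
      have h2 := hQfar v (by grind)
      omega
  obtain ⟨i, j, hij, hj, hnd⟩ := hM.exists_not_disjoint
    (fun i => if i < k then block b (b + 1) i ∪ block (N + 1 + t) t i
      else range b ∪ Ico N (N + 1 + t)) fun i hi => by
    split_ifs with h
    · exact ⟨hedge i h, b + (b + 1) * i, by simp [block]⟩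
    · exact ⟨hlast, N, by simp; omega⟩
  apply hnd
  have hik : i < k := by omega
  simp only [hik, if_true]
  rw [disjoint_left]
  intro x hx hx'
  have a1 := hD i hik x
  have a3 := hC i hik x
  rw [mem_union] at hx
  split_ifs at hx' with hjk
  · have d1 := disjoint_left.1 (disjoint_block (c := b) (w := b + 1) hij)
    specialize @d1 x
    have d2 := disjoint_left.1 (disjoint_block (c := N + 1 + t) (w := t) hij)
    specialize @d2 x
    have a2 := hD j hjk x
    have a4 := hC j hjk x
    rw [mem_union] at hx'
    rcases hx with h | h <;> rcases hx' with h' | h' <;>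
      grind
  · simp only [mem_union, mem_range, mem_Ico] at hx'
    rcases hx with h | h <;>
      simp only [h, forall_const] at a1 a3 <;> omega

lemma card_filter_card_sdiff_range_le (n m s q : ℕ) :
    ((powersetCard s (range n)).filter fun S => (S \ range m).card = q).card ≤
      m.choose (s - q) * (n - m).choose q := by
  have hcard : (powersetCard (s - q) (range m) ×ˢ powersetCard q (Ico m n)).card =
      m.choose (s - q) * (n - m).choose q := by
    simp
  rw [← hcard]
  refine card_le_card_of_injOn (fun S => (S ∩ range m, S \ range m)) ?_ ?_
  · intro S hS
    simp only [coe_filter, Set.mem_ofPred_eq, mem_powersetCard] at hS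
    have hc := card_inter_add_card_sdiff S (range m)
    simp only [mem_coe, mem_product, mem_powersetCard]
    refine ⟨⟨inter_subset_right, by omega⟩, fun x hx => ?_, hS.2⟩
    rw [mem_sdiff, mem_range] at hx
    exact mem_Ico.2 ⟨by omega, mem_range.1 (hS.1.1 hx.1)⟩
  · intro S _ T _ h
    simp only [Prod.mk.injEq] at h
    rw [← sdiff_union_inter S (range m), h.1, h.2, sdiff_union_inter]

lemma choose_le_card_filter_inter_range_eq {n m p t : ℕ} {B : Finset ℕ} (hmn : m ≤ n)
    (hB : B ⊆ range m) (hBp : B.card = p) :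
    (n - m).choose t ≤
      ((powersetCard (p + t) (range n)).filter fun S => S ∩ range m = B).card := by
  rw [← Nat.card_Ico, ← card_powersetCard]
  have hdisj : ∀ Q ⊆ Ico m n, Disjoint B Q := fun Q hQ => by
    rw [disjoint_left]
    intro x hx hx'
    have h1 := mem_range.1 (hB hx)
    have h2 := mem_Ico.1 (hQ hx')
    omega
  refine card_le_card_of_injOn (fun Q => B ∪ Q) ?_ ?_
  · intro Q hQ
    simp only [mem_coe, mem_powersetCard] at hQ
    simp only [coe_filter, Set.mem_ofPred_eq, mem_powersetCard]
    refine ⟨⟨union_subset (hB.trans (range_subset_range.2 hmn)) fun x hx =>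
      mem_range.2 (mem_Ico.1 (hQ.1 hx)).2, ?_⟩, ?_⟩
    · rw [card_union_of_disjoint (hdisj Q hQ.1), hBp, hQ.2]
    · ext x
      have h1 := @hB x
      have h2 := @hQ.1 x
      simp only [mem_range, mem_Ico, mem_inter, mem_union] at *
      grind
  · intro Q hQ Q' hQ' h
    simp only [mem_coe, mem_powersetCard] at hQ hQ'
    simp only at h
    rw [← union_sdiff_cancel_left (hdisj Q hQ.1), h, union_sdiff_cancel_left (hdisj Q' hQ'.1)]

lemma card_cliquesOn_le {n k b t p : ℕ} {H : Finset (Finset ℕ)} (hH : IsDownShifted H)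
    (hM : matchingLE H k) (hp : b * (k + 1) < p) (hp' : p < (b + 1) * (k + 1))
    (hmn : (b + 1 + t) * (k + 1) ≤ n)
    (hsum : ∑ q ∈ range t, ((b + 1 + t) * (k + 1)).choose (p + t - q) *
      (n - (b + 1 + t) * (k + 1)).choose q ≤ (n - (b + 1 + t) * (k + 1)).choose t) :
    (cliquesOn n (b + 1 + t) (p + t) H).card ≤ ((powersetCard (p + t) (range n)).filter
      fun S => p ≤ (S ∩ range (b * (k + 1) + k)).card).card := by
  by_cases hall : ∀ S ∈ cliquesOn n (b + 1 + t) (p + t) H,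
      p ≤ (S ∩ range (b * (k + 1) + k)).card
  · refine card_le_card fun S hS => mem_filter.2 ⟨?_, hall S hS⟩
    exact mem_powersetCard.2 (mem_cliquesOn.1 hS).1
  push Not at hall
  obtain ⟨S₀, hS₀, hlt⟩ := hall
  obtain ⟨B, hBN, hBp, hB⟩ := exists_forall_inter_ne hH hM hp hp' hS₀ hlt
  have hNm : b * (k + 1) + k ≤ (b + 1 + t) * (k + 1) := by
    have : (b + 1 + t) * (k + 1) = b * (k + 1) + (k + 1) + t * (k + 1) := by ring
    omega
  have hfar := fun S hS U => sdiff_subset_range_of_far hH hM hp hp' (n := n) (t := t)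
    (S := S) (U := U) hS
  generalize (b + 1 + t) * (k + 1) = m at *
  generalize b * (k + 1) + k = N at *
  set P := powersetCard (p + t) (range n) with hP
  set G := P.filter fun S => p ≤ (S ∩ range N).card with hG
  set T := P.filter fun S => S ∩ range m = B with hT
  set L := (range t).biUnion fun q => P.filter fun S => (S \ range m).card = q with hL
  have hTG : T ⊆ G := by
    intro S hS
    rw [hT, mem_filter] at hS
    refine mem_filter.2 ⟨hS.1, ?_⟩
    rw [← hBp]
    exact card_le_card (subset_inter (hS.2 ▸ inter_subset_left) hBN)
  have hLT : L.card ≤ T.card :=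
    calc L.card ≤ ∑ q ∈ range t, (P.filter fun S => (S \ range m).card = q).card :=
          card_biUnion_le
      _ ≤ ∑ q ∈ range t, m.choose (p + t - q) * (n - m).choose q :=
          sum_le_sum fun q _ => card_filter_card_sdiff_range_le n m (p + t) q
      _ ≤ (n - m).choose t := hsum
      _ ≤ T.card := choose_le_card_filter_inter_range_eq hmn
          (hBN.trans (range_subset_range.2 hNm)) hBp
  have hsub : cliquesOn n (b + 1 + t) (p + t) H ⊆ (G \ T) ∪ L := by
    intro S hS
    have hSc := mem_cliquesOn.1 hS
    have hSP : S ∈ P := mem_powersetCard.2 hSc.1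
    by_cases hlt' : (S \ range m).card < t
    · exact mem_union_right _
        (mem_biUnion.2 ⟨_, mem_range.2 hlt', mem_filter.2 ⟨hSP, rfl⟩⟩)
    obtain ⟨U, hU, hUt⟩ := exists_subset_card_eq (not_lt.1 hlt')
    have hUS : U ⊆ S := hU.trans sdiff_subset
    have hSU := hfar S hS U hUS hUt fun u hu => by simpa using (mem_sdiff.1 (hU hu)).2
    refine mem_union_left _ (mem_sdiff.2 ⟨mem_filter.2 ⟨hSP, ?_⟩, fun hST =>
      hB S hS (mem_filter.1 hST).2⟩)
    have hc : (S \ U).card = p := by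
      rw [card_sdiff_of_subset hUS, hSc.1.2, hUt]
      omega
    rw [← hc]
    exact card_le_card (subset_inter sdiff_subset hSU)
  calc _ ≤ ((G \ T) ∪ L).card := card_le_card hsub
    _ ≤ (G \ T).card + L.card := card_union_le _ _
    _ ≤ (G \ T).card + T.card := by omega
    _ = G.card := card_sdiff_add_card_eq_card hTG

lemma mul_choose_le_choose_succ {x q N : ℕ} (h : x * (q + 1) + q ≤ N) :
    x * N.choose q ≤ N.choose (q + 1) := by
  refine Nat.le_of_mul_le_mul_right (c := q + 1) ?_ (by omega)
  rw [Nat.choose_succ_right_eq, mul_right_comm, mul_comm]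
  exact Nat.mul_le_mul_left _ (by omega)

lemma choose_succ_le_mul_choose (m j : ℕ) : m.choose (j + 1) ≤ m * m.choose j := by
  calc m.choose (j + 1) ≤ m.choose (j + 1) * (j + 1) := Nat.le_mul_of_pos_right _ (by omega)
    _ = m.choose j * (m - j) := Nat.choose_succ_right_eq m j
    _ ≤ m * m.choose j := by
      rw [mul_comm]
      exact Nat.mul_le_mul_right _ (by omega)

lemma sum_range_le_of_two_mul_le {h : ℕ → ℕ} {t : ℕ} (hh : ∀ q < t, 2 * h q ≤ h (q + 1)) :
    ∑ q ∈ range t, h q ≤ h t := by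
  induction t with
  | zero => simp
  | succ t ih =>
    rw [sum_range_succ]
    have h1 := ih fun q hq => hh q (by omega)
    have h2 := hh t (by omega)
    omega

lemma sum_choose_mul_choose_le {m N p t : ℕ} (ht : 0 < t) (h1 : 2 * m * t + t ≤ N)
    (h2 : 2 * m.choose (p + 1) * t + t ≤ N) :
    ∑ q ∈ range t, m.choose (p + t - q) * N.choose q ≤ N.choose t := by
  obtain ⟨t, rfl⟩ := Nat.exists_eq_add_of_lt ht
  rw [zero_add, sum_range_succ] at *
  have hgeom : ∑ q ∈ range t, m.choose (p + (t + 1) - q) * N.choose q ≤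
      m.choose (p + (t + 1) - t) * N.choose t := by
    refine sum_range_le_of_two_mul_le fun q hq => ?_
    obtain ⟨j, hj⟩ : ∃ j, p + (t + 1) - q = j + 1 := ⟨p + t - q, by omega⟩
    rw [hj, show p + (t + 1) - (q + 1) = j by omega]
    calc 2 * (m.choose (j + 1) * N.choose q)
        ≤ 2 * (m * m.choose j * N.choose q) := by
          gcongr
          exact choose_succ_le_mul_choose m j
      _ = m.choose j * (2 * m * N.choose q) := by ring
      _ ≤ m.choose j * N.choose (q + 1) := by
          refine Nat.mul_le_mul_left _ (mul_choose_le_choose_succ ?_)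
          have : 2 * m * (q + 1) ≤ 2 * m * (t + 1) := Nat.mul_le_mul_left _ (by omega)
          omega
  have hlast := mul_choose_le_choose_succ (x := 2 * m.choose (p + 1)) (q := t) (N := N) (by omega)
  rw [show p + (t + 1) - t = p + 1 by omega] at *
  rw [mul_assoc] at hlast
  omega

lemma choose_le_exp_mul_pow {m p : ℕ} (hp : 0 < p) :
    (m.choose p : ℝ) ≤ (Real.exp 1 * (m / p)) ^ p := by
  have hp' : (0 : ℝ) < p := by exact_mod_cast hp
  have h := Real.pow_div_factorial_le_exp (p : ℝ) hp'.le p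
  calc (m.choose p : ℝ) ≤ m ^ p / p.factorial := Nat.choose_le_pow_div p m
    _ = (m / p) ^ p * (p ^ p / p.factorial) := by
      rw [div_pow]
      field_simp
    _ ≤ (m / p) ^ p * Real.exp p := by gcongr
    _ = (Real.exp 1 * (m / p)) ^ p := by
      rw [mul_pow, ← Real.exp_nat_mul, mul_one, mul_comm]

lemma sum_choose_mul_choose_le_of_large {n k b t p : ℕ} (hk : 0 < k) (hb : 0 < b) (ht : 0 < t)
    (hp : b * (k + 1) < p)
    (hn : 4 * ((b + 1 + t : ℕ) : ℝ) ^ 2 * k *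
      (Real.exp 1 * ((b + 1 + t : ℕ) : ℝ) / b) ^ p ≤ n) :
    (b + 1 + t) * (k + 1) ≤ n ∧
    ∑ q ∈ range t, ((b + 1 + t) * (k + 1)).choose (p + t - q) *
      (n - (b + 1 + t) * (k + 1)).choose q ≤ (n - (b + 1 + t) * (k + 1)).choose t := by
  obtain ⟨r, hr⟩ : ∃ r, b + 1 + t = r := ⟨_, rfl⟩
  rw [hr] at hn ⊢
  set X : ℝ := (Real.exp 1 * r / b) ^ p with hX
  have hb' : (0 : ℝ) < b := by exact_mod_cast hb
  have hp0 : (0 : ℝ) < p := by exact_mod_cast (by omega : 0 < p)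
  have hX2 : 2 ≤ X := by
    have h1 : (2 : ℝ) ≤ Real.exp 1 * r / b := by
      rw [le_div_iff₀ hb']
      have h2 := Real.add_one_le_exp (1 : ℝ)
      have h3 : (b : ℝ) ≤ r := by exact_mod_cast (by omega : b ≤ r)
      nlinarith
    exact h1.trans (le_self_pow₀ (by linarith) (by omega))
  have hchoose : ((r * (k + 1)).choose p : ℝ) ≤ X := by
    refine (choose_le_exp_mul_pow (by omega)).trans ?_
    rw [hX, mul_div_assoc]
    gcongr ?_ ^ p
    refine mul_le_mul_of_nonneg_left ?_ (Real.exp_pos 1).le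
    rw [div_le_div_iff₀ hp0 hb']
    have : ((b * (k + 1) : ℕ) : ℝ) ≤ p := by exact_mod_cast hp.le
    push_cast at this ⊢
    have hr0 : (0 : ℝ) ≤ r := by positivity
    nlinarith
  have hsucc : (r * (k + 1)).choose (p + 1) ≤ r * (r * (k + 1)).choose p := by
    refine Nat.le_of_mul_le_mul_right (c := p + 1) ?_ (by omega)
    rw [Nat.choose_succ_right_eq]
    have h1 : k + 1 ≤ p + 1 := by nlinarith
    calc (r * (k + 1)).choose p * (r * (k + 1) - p)
        ≤ (r * (k + 1)).choose p * (r * (p + 1)) := by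
          gcongr
          exact (Nat.sub_le _ _).trans (Nat.mul_le_mul_left _ h1)
      _ = r * (r * (k + 1)).choose p * (p + 1) := by ring
  have hk1 : (1 : ℝ) ≤ k := by exact_mod_cast hk
  have hr1 : (1 : ℝ) ≤ r := by exact_mod_cast (by omega : 1 ≤ r)
  have htr : (t : ℝ) ≤ r := by exact_mod_cast (by omega : t ≤ r)
  have ht0 : (0 : ℝ) ≤ t := by positivity
  have hrk : (r : ℝ) * k ≤ r ^ 2 * k := by
    nlinarith [mul_nonneg (sub_nonneg.2 hr1) (by positivity : (0 : ℝ) ≤ r * k)]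
  have hrrk : (r : ℝ) ≤ r * k := by nlinarith
  have hr2k : (r : ℝ) ^ 2 ≤ r ^ 2 * k := by nlinarith
  have hX2' : 2 * ((r : ℝ) ^ 2 * k) ≤ r ^ 2 * k * X := by
    nlinarith [mul_nonneg (sub_nonneg.2 hX2) (by positivity : (0 : ℝ) ≤ r ^ 2 * k)]
  have hn1 : 2 * (r * (k + 1)) * t + t + r * (k + 1) ≤ n := by
    have : (2 * (r * (k + 1)) * t + t + r * (k + 1) : ℝ) ≤ n := by
      have h1 : (r : ℝ) * (k + 1) * t ≤ r * (k + 1) * r := by gcongr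
      nlinarith
    exact_mod_cast this
  have hn2 : 2 * (r * (k + 1)).choose (p + 1) * t + t + r * (k + 1) ≤ n := by
    have : (2 * (r * (k + 1)).choose (p + 1) * t + t + r * (k + 1) : ℝ) ≤ n := by
      have h1 : ((r * (k + 1)).choose (p + 1) : ℝ) ≤ r * X :=
        (by exact_mod_cast hsucc : _ ≤ (r : ℝ) * (r * (k + 1)).choose p).trans (by gcongr)
      have h2 : ((r * (k + 1)).choose (p + 1) : ℝ) * t ≤ r * X * r := by gcongr
      have h3 : r ^ 2 * X ≤ r ^ 2 * k * X := by gcongr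
      nlinarith
    exact_mod_cast this
  exact ⟨by omega, sum_choose_mul_choose_le ht (by omega) (by omega)⟩

lemma matchingLE.map {V W : Type*} {H : Finset (Finset V)} {k : ℕ} (hM : matchingLE H k)
    (φ : V ↪ W) : matchingLE (H.map (mapEmbedding φ).toEmbedding) k := by
  intro M hMH hdisj
  obtain ⟨M', hM', rfl⟩ := subset_map_iff.1 hMH
  rw [card_map]
  refine hM M' hM' fun E hE F hF hne => ?_
  have := hdisj (mem_coe.2 (mem_map_of_mem _ hE)) (mem_coe.2 (mem_map_of_mem _ hF))
    fun h => hne ((mapEmbedding φ).injective h)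
  simpa using this

lemma cliqueCount_le_card_cliquesOn {V : Type*} [Fintype V] [DecidableEq V] {n r s : ℕ}
    (H : Finset (Finset V)) (φ : V ↪ ℕ) (hφ : ∀ v, φ v < n) :
    cliqueCount r s H ≤ (cliquesOn n r s (H.map (mapEmbedding φ).toEmbedding)).card := by
  refine card_le_card_of_injOn (fun S => S.map φ) (fun S hS => ?_)
    fun S _ T _ h => map_injective φ h
  simp only [coe_filter, Set.mem_ofPred_eq, mem_powersetCard] at hS
  rw [mem_coe, mem_cliquesOn, card_map]
  refine ⟨⟨fun x hx => ?_, hS.1.2⟩, fun F hF hFr => ?_⟩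
  · obtain ⟨v, -, rfl⟩ := mem_map.1 hx
    exact mem_range.2 (hφ v)
  · obtain ⟨F', hF', rfl⟩ := subset_map_iff.1 hF
    rw [card_map] at hFr
    exact mem_map_of_mem (mapEmbedding φ).toEmbedding
      (hS.2 (mem_powersetCard.2 ⟨hF', hFr⟩))

lemma card_filter_le_cliqueCount_Fnka (n k b t p : ℕ) :
    ((powersetCard (p + t) (range n)).filter
      fun S => p ≤ (S ∩ range (b * (k + 1) + k)).card).card ≤
      cliqueCount (b + 1 + t) (p + t) (Fnka n k (b + 1 + t) (b + 1)) := by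
  have hN : (b + 1) * k + (b + 1) - 1 = b * (k + 1) + k := by
    rw [show (b + 1) * k + (b + 1) = b * (k + 1) + k + 1 by ring]
    rfl
  rw [cliqueCount, Fnka, hN]
  generalize b * (k + 1) + k = N
  refine card_le_card_of_surjOn (fun S => S.map Fin.valEmbedding) fun S hS => ?_
  simp only [coe_filter, Set.mem_ofPred_eq, mem_powersetCard] at hS
  obtain ⟨⟨hSn, hSc⟩, hSp⟩ := hS
  have hmap : (S.attachFin fun x hx => mem_range.1 (hSn hx)).map Fin.valEmbedding = S :=
    map_valEmbedding_attachFin _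
  generalize S.attachFin _ = T at hmap
  subst hmap
  refine ⟨T, ?_, rfl⟩
  rw [card_map] at hSc
  simp only [coe_filter, Set.mem_ofPred_eq, mem_powersetCard]
  refine ⟨⟨subset_univ _, hSc⟩, fun E hE => ?_⟩
  rw [mem_powersetCard] at hE
  simp only [mem_filter, mem_powersetCard]
  refine ⟨⟨subset_univ _, hE.2⟩, ?_⟩
  have h1 : (T.map Fin.valEmbedding ∩ range N).card =
      (T.filter fun x : Fin n => (x : ℕ) < N).card := by
    rw [← card_map (Fin.valEmbedding (n := n))]
    congr 1
    ext x
    simp only [mem_inter, mem_map, mem_range, mem_filter, Fin.valEmbedding_apply]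
    grind
  have h2 := card_filter_add_card_filter_not (s := T) (fun x : Fin n => (x : ℕ) < N)
  have h3 := card_filter_add_card_filter_not (s := E) (fun x : Fin n => (x : ℕ) < N)
  have h4 := card_le_card (filter_subset_filter (fun x : Fin n => ¬ (x : ℕ) < N) hE.1)
  omega

/-- Theorem 1.3 (II). -/
theorem max_cliques_middle_s {V : Type*} [Fintype V] [DecidableEq V] {n k r s a : ℕ}
    (hn0 : 0 < n) (hk0 : 0 < k) (hr0 : 0 < r) (hs0 : 0 < s)
    (hs1 : k + r ≤ s) (hs2 : s ≤ (r - 1) * (k + 1))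
    (ha : a = (s - r) / k + 1)
    (hcard : Fintype.card V = n)
    (H : Finset (Finset V)) (hunif : ∀ E ∈ H, E.card = r)
    (hmatch : matchingLE H k)
    (hn : 4 * r ^ 2 * k * (Real.exp 1 * r / ((a : ℝ) - 1)) ^ (s - r + a) ≤ (n : ℝ)) :
    cliqueCount r s H ≤ cliqueCount r s (Fnka n k r a) := by
  obtain ⟨b, hb⟩ : ∃ b, b = (s - r) / k := ⟨_, rfl⟩
  rw [← hb] at ha
  subst ha
  have hb0 : 0 < b := hb ▸ Nat.div_pos (by omega) hk0
  have hble : b * k ≤ s - r := hb ▸ Nat.div_mul_le_self _ _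
  have hblt : s - r < (b + 1) * k := hb ▸ (Nat.div_lt_iff_lt_mul hk0).1 (Nat.lt_succ_self _)
  have hbr : b + 1 < r := by
    obtain ⟨r', rfl⟩ := Nat.exists_eq_add_of_lt hr0
    simp only [zero_add, Nat.add_sub_cancel] at *
    rw [mul_add] at hs2
    by_contra! hcon
    have : r' * k ≤ b * k := Nat.mul_le_mul_right _ (by omega)
    omega
  obtain ⟨t, rfl⟩ : ∃ t, r = b + 1 + t := ⟨r - (b + 1), by omega⟩
  obtain ⟨p, rfl⟩ : ∃ p, s = p + t := ⟨s - t, by omega⟩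
  have hexp : p + t - (b + 1 + t) + (b + 1) = p := by omega
  have e1 : (b + 1) * (k + 1) = (b + 1) * k + b + 1 := by ring
  have e2 : b * (k + 1) = b * k + b := by ring
  have hp : b * (k + 1) < p := by omega
  have hp' : p < (b + 1) * (k + 1) := by omega
  rw [hexp, show (((b + 1 : ℕ) : ℝ) - 1) = b by push_cast; ring] at hn
  obtain ⟨hmn, hsum⟩ := sum_choose_mul_choose_le_of_large hk0 hb0 (by omega) hp hn
  let φ : V ↪ ℕ := (Fintype.equivFinOfCardEq hcard).toEmbedding.trans Fin.valEmbedding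
  have hφ : ∀ v, φ v < n := fun v => (Fintype.equivFinOfCardEq hcard v).isLt
  obtain ⟨H', -, hM', hH', hle⟩ := exists_isDownShifted (p + t)
    (H.map (mapEmbedding φ).toEmbedding) (n := n) (r := b + 1 + t) (fun E hE => by
      obtain ⟨F, hF, rfl⟩ := mem_map.1 hE
      simp only [RelEmbedding.coe_toEmbedding, mapEmbedding_apply, mem_powersetCard, card_map]
      refine ⟨fun x hx => ?_, hunif F hF⟩
      obtain ⟨v, -, rfl⟩ := mem_map.1 hx
      exact mem_range.2 (hφ v)) (hmatch.map φ)
  calc cliqueCount (b + 1 + t) (p + t) H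
      ≤ _ := cliqueCount_le_card_cliquesOn H φ hφ
    _ ≤ _ := hle
    _ ≤ _ := card_cliquesOn_le hH' hM' hp hp' hmn hsum
    _ ≤ _ := card_filter_le_cliqueCount_Fnka n k b t p
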